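/- Let N ≥ 2, k ∈ ℕ with k ≥ 1, and α > k. Then for x ≠ 0 in ℝ^N, (-1)^k div_k(|x|^{2α-N} ∇^k(|x|^{k-α})) = λ_N^{k-α,k} · |x|^{α-N-k}, where λ_N^{k-α,k} is the constant in the identity |∇^k |x|^{k-α}|² = λ_N^{k-α,k}|x|^{-2α}. -/

import Mathlib

open Real

noncomputable section

/-- The iterated mixed partial derivative `∂^k f/∂x_{i 0} ⋯ ∂x_{i (k-1)}` at `x`. -/
def pD {N : ℕ} (k : ℕ) (f : EuclideanSpace ℝ (Fin N) → ℝ) (i : Fin k → Fin N)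
    (x : EuclideanSpace ℝ (Fin N)) : ℝ :=
  iteratedFDeriv ℝ k f x (fun j => EuclideanSpace.single (i j) 1)

/-- The eigenvalue in `Δ |x|ˢ = s (s + n - 2) |x|ˢ⁻²`. -/
def powLaplacianCoeff (n s : ℝ) : ℝ := s * (s + n - 2)

/-- The coefficient in `⟨∇ᵏ |x|ˢ, ∇ᵏ |x|ᵗ⟩ = c |x|ˢ⁺ᵗ⁻²ᵏ`. -/
def powPairingCoeff (n : ℝ) : ℕ → ℝ → ℝ → ℝ
  | 0, _, _ => 1
  | k + 1, s, t => (powLaplacianCoeff n (s + t - 2 * k) * powPairingCoeff n k s t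
      - powLaplacianCoeff n s * powPairingCoeff n k (s - 2) t
      - powLaplacianCoeff n t * powPairingCoeff n k s (t - 2)) / 2

section CommutingDerivations

variable {A ι : Type*} [CommRing A] [Algebra ℝ A] [Fintype ι] (d : ι → Derivation ℝ A A)

/-- The iterated derivative `d (i 0) (d (i 1) (⋯ (d (i (k-1)) f)))`. -/
def iterDeriv : (k : ℕ) → (Fin k → ι) → A → A
  | 0, _, f => f
  | k + 1, i, f => d (i 0) (iterDeriv k (Fin.tail i) f)

/-- The Laplacian `∑ j, d j (d j f)`. -/
def derivLaplacian (f : A) : A := ∑ j, d j (d j f)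

/-- The pairing `⟨∇ᵏ f, ∇ᵏ g⟩`. -/
def gradPairing : ℕ → A → A → A
  | 0, f, g => f * g
  | k + 1, f, g => ∑ j, gradPairing k (d j f) (d j g)

/-- The operator `f ↦ divₖ (h ∇ᵏ f)`. -/
def divGrad : ℕ → A → A → A
  | 0, h, f => h * f
  | k + 1, h, f => ∑ j, d j (divGrad k h (d j f))

variable {d}

theorem gradPairing_smul_left (k : ℕ) (c : ℝ) (f g : A) :
    gradPairing d k (c • f) g = c • gradPairing d k f g := by
  induction k generalizing f g with
  | zero => simp [gradPairing]
  | succ k ih => simp [gradPairing, ih, Finset.smul_sum]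

theorem gradPairing_smul_right (k : ℕ) (c : ℝ) (f g : A) :
    gradPairing d k f (c • g) = c • gradPairing d k f g := by
  induction k generalizing f g with
  | zero => simp [gradPairing]
  | succ k ih => simp [gradPairing, ih, Finset.smul_sum]

theorem divGrad_smul_left (k : ℕ) (c : ℝ) (h f : A) :
    divGrad d k (c • h) f = c • divGrad d k h f := by
  induction k generalizing f with
  | zero => simp [divGrad]
  | succ k ih => simp [divGrad, ih, Finset.smul_sum]

theorem divGrad_smul_right (k : ℕ) (c : ℝ) (h f : A) :
    divGrad d k h (c • f) = c • divGrad d k h f := by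
  induction k generalizing f with
  | zero => simp [divGrad]
  | succ k ih => simp [divGrad, ih, Finset.smul_sum]

theorem derivLaplacian_smul (c : ℝ) (f : A) :
    derivLaplacian d (c • f) = c • derivLaplacian d f := by
  simp [derivLaplacian, Finset.smul_sum]

theorem derivLaplacian_mul (f g : A) :
    derivLaplacian d (f * g) =
      derivLaplacian d f * g + 2 * ∑ j, d j f * d j g + f * derivLaplacian d g := by
  simp only [derivLaplacian, Finset.sum_mul, Finset.mul_sum, ← Finset.sum_add_distrib]
  refine Finset.sum_congr rfl fun j _ => ?_
  simp only [Derivation.leibniz, map_add, smul_eq_mul]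
  ring

theorem sum_fin_succ_pi {M : Type*} [AddCommMonoid M] (k : ℕ) (F : (Fin (k + 1) → ι) → M) :
    ∑ i, F i = ∑ j, ∑ i : Fin k → ι, F (Fin.cons j i) := by
  rw [← (Fin.consEquiv fun _ => ι).sum_comp, Fintype.sum_prod_type]
  rfl

variable (hd : ∀ i j f, d i (d j f) = d j (d i f))

include hd

theorem derivLaplacian_comm (j : ι) (f : A) :
    derivLaplacian d (d j f) = d j (derivLaplacian d f) := by
  simp only [derivLaplacian, map_sum]
  exact Finset.sum_congr rfl fun i _ => by rw [hd i j, hd i j]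

omit [Fintype ι] in
theorem iterDeriv_cons (k : ℕ) (j : ι) (i : Fin k → ι) (f : A) :
    iterDeriv d (k + 1) (Fin.cons j i) f = iterDeriv d k i (d j f) := by
  have key : ∀ (k : ℕ) (i : Fin k → ι), d j (iterDeriv d k i f) = iterDeriv d k i (d j f) := by
    intro k
    induction k with
    | zero => intro i; rfl
    | succ k ih => intro i; rw [iterDeriv, hd, ih, iterDeriv]
  simpa [iterDeriv] using key k i

theorem sum_iterDeriv_mul (k : ℕ) (f g : A) :
    ∑ i, iterDeriv d k i f * iterDeriv d k i g = gradPairing d k f g := by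
  induction k generalizing f g with
  | zero => simp [iterDeriv, gradPairing]
  | succ k ih => simp only [sum_fin_succ_pi, iterDeriv_cons hd, ih, gradPairing]

theorem sum_iterDeriv_mul_iterDeriv (k : ℕ) (h f : A) :
    ∑ i, iterDeriv d k i (h * iterDeriv d k i f) = divGrad d k h f := by
  induction k generalizing f with
  | zero => simp [iterDeriv, divGrad]
  | succ k ih =>
    rw [sum_fin_succ_pi, divGrad]
    refine Finset.sum_congr rfl fun j _ => ?_
    rw [← ih, map_sum]
    refine Finset.sum_congr rfl fun i _ => ?_
    rw [iterDeriv_cons hd k j i f]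
    simp [iterDeriv]

theorem two_mul_gradPairing_succ (k : ℕ) (f g : A) :
    2 * gradPairing d (k + 1) f g = derivLaplacian d (gradPairing d k f g)
      - gradPairing d k (derivLaplacian d f) g - gradPairing d k f (derivLaplacian d g) := by
  induction k generalizing f g with
  | zero =>
    simp only [gradPairing, derivLaplacian_mul]
    ring
  | succ k ih =>
    rw [gradPairing, Finset.mul_sum, Finset.sum_congr rfl fun j _ => ih (d j f) (d j g)]
    simp only [gradPairing, Finset.sum_sub_distrib, derivLaplacian_comm hd]
    congr 2
    simp only [derivLaplacian, map_sum]
    exact Finset.sum_comm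

theorem two_mul_divGrad_succ (k : ℕ) (h f : A) :
    2 * divGrad d (k + 1) h f = derivLaplacian d (divGrad d k h f)
      + divGrad d k h (derivLaplacian d f) - divGrad d k (derivLaplacian d h) f := by
  induction k generalizing f with
  | zero =>
    simp only [divGrad, derivLaplacian_mul, Derivation.leibniz, smul_eq_mul,
      Finset.sum_add_distrib, ← Finset.mul_sum]
    rw [show ∑ j, d j (d j f) = derivLaplacian d f from rfl]
    rw [Finset.sum_congr rfl fun j _ => mul_comm (d j f) (d j h)]
    ring
  | succ k ih =>
    have two_mul_d (j : ι) (a : A) : 2 * d j a = d j (2 * a) := by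
      rw [two_mul, two_mul, map_add]
    rw [divGrad, Finset.mul_sum]
    simp only [two_mul_d, ih]
    simp only [divGrad, map_sub, map_add, Finset.sum_sub_distrib, Finset.sum_add_distrib,
      derivLaplacian_comm hd]
    congr 2
    simp only [← derivLaplacian_comm hd]
    simp only [derivLaplacian, map_sum]
    exact Finset.sum_comm

variable {n : ℝ} {r : ℝ → A} (hr : ∀ s t, r s * r t = r (s + t))
  (hΔ : ∀ s, derivLaplacian d (r s) = powLaplacianCoeff n s • r (s - 2))

include hr hΔ

theorem gradPairing_pow (k : ℕ) (s t : ℝ) :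
    gradPairing d k (r s) (r t) = powPairingCoeff n k s t • r (s + t - 2 * k) := by
  induction k generalizing s t with
  | zero => simp [gradPairing, powPairingCoeff, hr]
  | succ k ih =>
    have h := two_mul_gradPairing_succ hd k (r s) (r t)
    rw [hΔ, hΔ, gradPairing_smul_left, gradPairing_smul_right, ih, ih, ih, derivLaplacian_smul, hΔ,
      show s - 2 + t - 2 * k = s + t - 2 * ↑(k + 1) by push_cast; ring,
      show s + (t - 2) - 2 * k = s + t - 2 * ↑(k + 1) by push_cast; ring,
      show s + t - 2 * k - 2 = s + t - 2 * ↑(k + 1) by push_cast; ring] at h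
    have h2 : gradPairing d (k + 1) (r s) (r t)
        = (1 / 2 : ℝ) • (2 * gradPairing d (k + 1) (r s) (r t)) := by
      rw [two_mul, ← two_smul ℝ, smul_smul]
      norm_num
    rw [h2, h, powPairingCoeff]
    module

theorem divGrad_pow (k : ℕ) (p s : ℝ) :
    divGrad d k (r p) (r s) =
      ((-1) ^ k * powPairingCoeff n k s (2 * k - n - p - s)) • r (p + s - 2 * k) := by
  induction k generalizing p s with
  | zero => simp [divGrad, powPairingCoeff, hr]
  | succ k ih =>
    have h := two_mul_divGrad_succ hd k (r p) (r s)
    rw [hΔ, hΔ, divGrad_smul_left, divGrad_smul_right, ih, ih, ih, derivLaplacian_smul, hΔ,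
      show p + (s - 2) - 2 * k = p + s - 2 * ↑(k + 1) by push_cast; ring,
      show p - 2 + s - 2 * k = p + s - 2 * ↑(k + 1) by push_cast; ring,
      show p + s - 2 * k - 2 = p + s - 2 * ↑(k + 1) by push_cast; ring,
      show 2 * k - n - p - (s - 2) = 2 * ↑(k + 1) - n - p - s by push_cast; ring,
      show 2 * k - n - (p - 2) - s = 2 * ↑(k + 1) - n - p - s by push_cast; ring,
      show 2 * k - n - p - s = 2 * ↑(k + 1) - n - p - s - 2 by push_cast; ring] at h
    have h2 : divGrad d (k + 1) (r p) (r s)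
        = (1 / 2 : ℝ) • (2 * divGrad d (k + 1) (r p) (r s)) := by
      rw [two_mul, ← two_smul ℝ, smul_smul]
      norm_num
    rw [h2, h, powPairingCoeff]
    simp only [smul_smul, ← add_smul, ← sub_smul]
    congr 1
    generalize powPairingCoeff n k = C
    rw [show powLaplacianCoeff n (p + s - 2 * k)
        = powLaplacianCoeff n (2 * ↑(k + 1) - n - p - s) by
          simp only [powLaplacianCoeff]; push_cast; ring,
      show powLaplacianCoeff n p
        = powLaplacianCoeff n (s + (2 * ↑(k + 1) - n - p - s) - 2 * k) by
          simp only [powLaplacianCoeff]; push_cast; ring]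
    ring

end CommutingDerivations

section PuncturedSpace

open Filter Topology
open scoped ContDiff

variable {N : ℕ}

/-- Extension by zero of a function on the punctured Euclidean space. -/
def puncturedExt (f : {x : EuclideanSpace ℝ (Fin N) // x ≠ 0} → ℝ)
    (x : EuclideanSpace ℝ (Fin N)) : ℝ :=
  open Classical in if h : x ≠ 0 then f ⟨x, h⟩ else 0

theorem puncturedExt_of_ne (f : {x : EuclideanSpace ℝ (Fin N) // x ≠ 0} → ℝ)
    {x : EuclideanSpace ℝ (Fin N)} (hx : x ≠ 0) : puncturedExt f x = f ⟨x, hx⟩ :=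
  dif_pos hx

theorem puncturedExt_restrict_eventuallyEq (F : EuclideanSpace ℝ (Fin N) → ℝ)
    {x : EuclideanSpace ℝ (Fin N)} (hx : x ≠ 0) :
    puncturedExt (fun y => F y) =ᶠ[𝓝 x] F := by
  filter_upwards [isOpen_ne.mem_nhds hx] with y hy
  exact puncturedExt_of_ne _ hy

variable (N) in
/-- The subalgebra of smooth functions on the punctured Euclidean space. -/
def puncturedSubalgebra : Subalgebra ℝ ({x : EuclideanSpace ℝ (Fin N) // x ≠ 0} → ℝ) where
  carrier := {f | ∀ x, x ≠ 0 → ContDiffAt ℝ ∞ (puncturedExt f) x}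
  mul_mem' {f g} hf hg x hx := ((hf x hx).mul (hg x hx)).congr_of_eventuallyEq <| by
    filter_upwards [isOpen_ne.mem_nhds hx] with y hy
    simp [puncturedExt_of_ne _ hy]
  add_mem' {f g} hf hg x hx := ((hf x hx).add (hg x hx)).congr_of_eventuallyEq <| by
    filter_upwards [isOpen_ne.mem_nhds hx] with y hy
    simp [puncturedExt_of_ne _ hy]
  algebraMap_mem' c x hx := (contDiffAt_const (c := c)).congr_of_eventuallyEq <| by
    filter_upwards [isOpen_ne.mem_nhds hx] with y hy
    simp [puncturedExt_of_ne _ hy]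

variable (N) in
/-- The algebra of smooth functions on the punctured Euclidean space. -/
def PuncturedSmooth : Type := puncturedSubalgebra N

namespace PuncturedSmooth

instance : CommRing (PuncturedSmooth N) := inferInstanceAs (CommRing (puncturedSubalgebra N))

instance : Algebra ℝ (PuncturedSmooth N) := inferInstanceAs (Algebra ℝ (puncturedSubalgebra N))

/-- The underlying function on the punctured space. -/
def eval (f : PuncturedSmooth N) : {x : EuclideanSpace ℝ (Fin N) // x ≠ 0} → ℝ :=
  Subtype.val (p := (· ∈ puncturedSubalgebra N)) f

@[ext]
theorem ext {f g : PuncturedSmooth N} (h : ∀ x, f.eval x = g.eval x) : f = g :=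
  Subtype.ext (funext h)

@[simp]
theorem eval_add (f g : PuncturedSmooth N) : (f + g).eval = f.eval + g.eval :=
  rfl

@[simp]
theorem eval_mul (f g : PuncturedSmooth N) : (f * g).eval = f.eval * g.eval :=
  rfl

@[simp]
theorem eval_smul (c : ℝ) (f : PuncturedSmooth N) : (c • f).eval = c • f.eval :=
  rfl

@[simp]
theorem eval_one : (1 : PuncturedSmooth N).eval = 1 :=
  rfl

/-- Evaluation at a point of the punctured space. -/
def evalAt (x : {x : EuclideanSpace ℝ (Fin N) // x ≠ 0}) : PuncturedSmooth N →ₗ[ℝ] ℝ where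
  toFun f := f.eval x
  map_add' _ _ := rfl
  map_smul' _ _ := rfl

theorem eval_sum {ι : Type*} (s : Finset ι) (f : ι → PuncturedSmooth N)
    (x : {x : EuclideanSpace ℝ (Fin N) // x ≠ 0}) :
    (∑ i ∈ s, f i).eval x = ∑ i ∈ s, (f i).eval x :=
  map_sum (evalAt x) f s

theorem contDiffAt (f : PuncturedSmooth N) {x : EuclideanSpace ℝ (Fin N)} (hx : x ≠ 0) :
    ContDiffAt ℝ ∞ (puncturedExt f.eval) x :=
  Subtype.property (p := (· ∈ puncturedSubalgebra N)) f x hx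

/-- Restriction to the punctured space of a function that is smooth there. -/
def restrict (F : EuclideanSpace ℝ (Fin N) → ℝ)
    (hF : ∀ x, x ≠ 0 → ContDiffAt ℝ ∞ F x) : PuncturedSmooth N :=
  (⟨fun y => F y, fun x hx =>
    (hF x hx).congr_of_eventuallyEq (puncturedExt_restrict_eventuallyEq F hx)⟩ :
    puncturedSubalgebra N)

@[simp]
theorem eval_restrict (F : EuclideanSpace ℝ (Fin N) → ℝ)
    (hF : ∀ x, x ≠ 0 → ContDiffAt ℝ ∞ F x) (x : {x : EuclideanSpace ℝ (Fin N) // x ≠ 0}) :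
    (restrict F hF).eval x = F x :=
  rfl

theorem differentiableAt (f : PuncturedSmooth N) {x : EuclideanSpace ℝ (Fin N)} (hx : x ≠ 0) :
    DifferentiableAt ℝ (puncturedExt f.eval) x :=
  (f.contDiffAt hx).differentiableAt (by simp)

/-- The `j`-th partial derivative as a linear map. -/
def partialLinear (j : Fin N) : PuncturedSmooth N →ₗ[ℝ] PuncturedSmooth N where
  toFun f := restrict (fun x => fderiv ℝ (puncturedExt f.eval) x (EuclideanSpace.single j 1))
    fun x hx => ((f.contDiffAt hx).fderiv_right (m := ∞) (by simp)).clm_apply contDiffAt_const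
  map_add' f g := by
    ext x
    have h : puncturedExt (f.eval + g.eval) =ᶠ[𝓝 x.1]
        puncturedExt f.eval + puncturedExt g.eval := by
      filter_upwards [isOpen_ne.mem_nhds x.2] with y hy
      simp [puncturedExt_of_ne _ hy]
    simp [h.fderiv_eq, fderiv_add (f.differentiableAt x.2) (g.differentiableAt x.2)]
  map_smul' c f := by
    ext x
    have h : puncturedExt (c • f.eval) =ᶠ[𝓝 x.1] c • puncturedExt f.eval := by
      filter_upwards [isOpen_ne.mem_nhds x.2] with y hy
      simp [puncturedExt_of_ne _ hy]
    simp [h.fderiv_eq, fderiv_const_smul (f.differentiableAt x.2)]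

/-- The `j`-th partial derivative as a derivation. -/
def partialDeriv (j : Fin N) : Derivation ℝ (PuncturedSmooth N) (PuncturedSmooth N) :=
  Derivation.mk' (partialLinear j) fun f g => by
    ext x
    have h : puncturedExt (f.eval * g.eval) =ᶠ[𝓝 x.1]
        puncturedExt f.eval * puncturedExt g.eval := by
      filter_upwards [isOpen_ne.mem_nhds x.2] with y hy
      simp [puncturedExt_of_ne _ hy]
    simp [partialLinear, h.fderiv_eq,
      fderiv_mul (f.differentiableAt x.2) (g.differentiableAt x.2), puncturedExt_of_ne _ x.2]

theorem partialDeriv_apply (j : Fin N) (f : PuncturedSmooth N)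
    (x : {x : EuclideanSpace ℝ (Fin N) // x ≠ 0}) :
    (partialDeriv j f).eval x = fderiv ℝ (puncturedExt f.eval) x (EuclideanSpace.single j 1) :=
  rfl

theorem puncturedExt_partialDeriv_eventuallyEq (j : Fin N) (f : PuncturedSmooth N)
    {x : EuclideanSpace ℝ (Fin N)} (hx : x ≠ 0) :
    puncturedExt (partialDeriv j f).eval =ᶠ[𝓝 x]
      fun y => fderiv ℝ (puncturedExt f.eval) y (EuclideanSpace.single j 1) :=
  puncturedExt_restrict_eventuallyEq
    (fun y => fderiv ℝ (puncturedExt f.eval) y (EuclideanSpace.single j 1)) hx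

theorem partialDeriv_restrict (j : Fin N) (F : EuclideanSpace ℝ (Fin N) → ℝ)
    (hF : ∀ x, x ≠ 0 → ContDiffAt ℝ ∞ F x) (x : {x : EuclideanSpace ℝ (Fin N) // x ≠ 0}) :
    (partialDeriv j (restrict F hF)).eval x = fderiv ℝ F x (EuclideanSpace.single j 1) := by
  rw [partialDeriv_apply]
  exact DFunLike.congr_fun (puncturedExt_restrict_eventuallyEq F x.2).fderiv_eq _

theorem partialDeriv_comm (i j : Fin N) (f : PuncturedSmooth N) :
    partialDeriv i (partialDeriv j f) = partialDeriv j (partialDeriv i f) := by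
  ext x
  have hdiff : DifferentiableAt ℝ (fderiv ℝ (puncturedExt f.eval)) x.1 :=
    ((f.contDiffAt x.2).fderiv_right (m := ∞) (by simp)).differentiableAt (by simp)
  have h (a b : Fin N) : (partialDeriv a (partialDeriv b f)).eval x =
      fderiv ℝ (fderiv ℝ (puncturedExt f.eval)) x (EuclideanSpace.single a 1)
        (EuclideanSpace.single b 1) := by
    rw [partialDeriv_apply, (puncturedExt_partialDeriv_eventuallyEq b f x.2).fderiv_eq,
      fderiv_clm_apply hdiff (differentiableAt_const _)]
    simp
  rw [h, h]
  have h_two : minSmoothness ℝ 2 ≤ ∞ := by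
    simpa using WithTop.coe_le_coe.mpr (le_top : (2 : ℕ∞) ≤ ⊤)
  exact (f.contDiffAt x.2).isSymmSndFDerivAt h_two _ _

theorem pD_puncturedExt (k : ℕ) (i : Fin k → Fin N) (f : PuncturedSmooth N)
    {x : EuclideanSpace ℝ (Fin N)} (hx : x ≠ 0) :
    pD k (puncturedExt f.eval) i x = (iterDeriv partialDeriv k i f).eval ⟨x, hx⟩ := by
  induction k generalizing x with
  | zero => simp [pD, iterDeriv, puncturedExt_of_ne _ hx]
  | succ k ih =>
    have hev : puncturedExt (iterDeriv partialDeriv k (Fin.tail i) f).eval =ᶠ[𝓝 x]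
        fun y => iteratedFDeriv ℝ k (puncturedExt f.eval) y
          (fun j => EuclideanSpace.single (Fin.tail i j) 1) := by
      filter_upwards [isOpen_ne.mem_nhds hx] with y hy
      rw [puncturedExt_of_ne _ hy, ← ih (Fin.tail i) hy]
      rfl
    have hdiff : DifferentiableAt ℝ (iteratedFDeriv ℝ k (puncturedExt f.eval)) x :=
      (f.contDiffAt hx).differentiableAt_iteratedFDeriv (by exact_mod_cast WithTop.coe_lt_top _)
    rw [iterDeriv, partialDeriv_apply, hev.fderiv_eq, pD, iteratedFDeriv_succ_apply_left,
      fderiv_continuousMultilinear_apply_const_apply hdiff]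
    rfl

theorem pD_restrict (k : ℕ) (i : Fin k → Fin N) (F : EuclideanSpace ℝ (Fin N) → ℝ)
    (f : PuncturedSmooth N) (hF : ∀ y : {x : EuclideanSpace ℝ (Fin N) // x ≠ 0}, F y = f.eval y)
    {x : EuclideanSpace ℝ (Fin N)} (hx : x ≠ 0) :
    pD k F i x = (iterDeriv partialDeriv k i f).eval ⟨x, hx⟩ := by
  have h : F =ᶠ[𝓝 x] puncturedExt f.eval := by
    filter_upwards [isOpen_ne.mem_nhds hx] with y hy
    rw [puncturedExt_of_ne _ hy, ← hF]
  rw [← pD_puncturedExt k i f hx, pD, pD, (h.iteratedFDeriv ℝ k).eq_of_nhds]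

theorem norm_rpow_eq (s : ℝ) (x : EuclideanSpace ℝ (Fin N)) :
    ‖x‖ ^ s = (‖x‖ ^ 2) ^ (s / 2) := by
  rw [← Real.rpow_natCast, ← Real.rpow_mul (norm_nonneg x)]
  congr 1
  push_cast
  ring

variable (N) in
/-- The function `|x|ˢ`. -/
def normPow (s : ℝ) : PuncturedSmooth N :=
  restrict (fun x => ‖x‖ ^ s) fun _ hx =>
    (contDiffAt_id.norm ℝ hx).rpow_const_of_ne (norm_ne_zero_iff.mpr hx)

/-- The `j`-th coordinate function. -/
def coord (j : Fin N) : PuncturedSmooth N :=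
  restrict (EuclideanSpace.proj (𝕜 := ℝ) j) fun _ _ =>
    (EuclideanSpace.proj (𝕜 := ℝ) j).contDiff.contDiffAt

theorem normPow_mul (s t : ℝ) : normPow N s * normPow N t = normPow N (s + t) := by
  ext x
  exact (Real.rpow_add (norm_pos_iff.mpr x.2) s t).symm

theorem partialDeriv_coord (j : Fin N) : partialDeriv j (coord j) = 1 := by
  ext x
  rw [coord, partialDeriv_restrict, ContinuousLinearMap.fderiv]
  simp

theorem sum_coord_mul_coord : ∑ j, coord j * coord j = normPow N 2 := by
  ext x
  simp only [eval_sum, eval_mul, Pi.mul_apply]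
  simp [coord, normPow, EuclideanSpace.norm_sq_eq, ← sq]

theorem partialDeriv_normPow (j : Fin N) (s : ℝ) :
    partialDeriv j (normPow N s) = s • (coord j * normPow N (s - 2)) := by
  ext x
  have hx : ‖x.1‖ ^ 2 ≠ 0 := pow_ne_zero 2 (norm_ne_zero_iff.mpr x.2)
  have h : HasFDerivAt (fun y : EuclideanSpace ℝ (Fin N) => ‖y‖ ^ s)
      ((s / 2 * (‖x.1‖ ^ 2) ^ (s / 2 - 1)) • (2 • innerSL ℝ x.1)) x.1 := by
    simp_rw [norm_rpow_eq s]
    exact ((hasFDerivAt_id x.1).norm_sq).rpow_const (p := s / 2) (Or.inl hx)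
  rw [normPow, partialDeriv_restrict, h.fderiv]
  simp [coord, normPow, norm_rpow_eq (s - 2), sub_div, EuclideanSpace.inner_single_right]
  ring

theorem derivLaplacian_normPow (s : ℝ) :
    derivLaplacian partialDeriv (normPow N s) =
      powLaplacianCoeff N s • normPow N (s - 2) := by
  have h (j : Fin N) : partialDeriv j (partialDeriv j (normPow N s)) =
      s • normPow N (s - 2) + (s * (s - 2)) • (coord j * coord j * normPow N (s - 2 - 2)) := by
    rw [partialDeriv_normPow, Derivation.map_smul, Derivation.leibniz, partialDeriv_normPow,
      partialDeriv_coord, smul_eq_mul, smul_eq_mul, mul_one, mul_smul_comm, smul_add, smul_smul,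
      mul_assoc, add_comm]
  simp only [derivLaplacian, h, Finset.sum_add_distrib, ← Finset.smul_sum, ← Finset.sum_mul,
    sum_coord_mul_coord, normPow_mul, Finset.sum_const, Finset.card_univ, Fintype.card_fin]
  rw [add_sub_cancel, powLaplacianCoeff, ← Nat.cast_smul_eq_nsmul ℝ]
  module

theorem sum_sq_iterDeriv_normPow (k : ℕ) (s : ℝ)
    (x : {x : EuclideanSpace ℝ (Fin N) // x ≠ 0}) :
    ∑ i, (iterDeriv partialDeriv k i (normPow N s)).eval x ^ 2 =
      powPairingCoeff N k s s * ‖x.1‖ ^ (s + s - 2 * k) := by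
  have h := (sum_iterDeriv_mul partialDeriv_comm k (normPow N s) (normPow N s)).trans
    (gradPairing_pow partialDeriv_comm normPow_mul derivLaplacian_normPow k s s)
  have hx := congrFun (congrArg eval h) x
  rw [eval_sum] at hx
  simp only [sq]
  exact hx

theorem sum_iterDeriv_normPow_mul (k : ℕ) (p s : ℝ)
    (x : {x : EuclideanSpace ℝ (Fin N) // x ≠ 0}) :
    ∑ i, (iterDeriv partialDeriv k i
        (normPow N p * iterDeriv partialDeriv k i (normPow N s))).eval x =
      (-1) ^ k * powPairingCoeff N k s (2 * k - N - p - s) * ‖x.1‖ ^ (p + s - 2 * k) := by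
  have h := (sum_iterDeriv_mul_iterDeriv partialDeriv_comm k (normPow N p) (normPow N s)).trans
    (divGrad_pow partialDeriv_comm normPow_mul derivLaplacian_normPow k p s)
  have hx := congrFun (congrArg eval h) x
  rw [eval_sum] at hx
  exact hx

end PuncturedSmooth

end PuncturedSpace

theorem divk_rpow_identity (N k : ℕ) (hN : 2 ≤ N) (hk : 1 ≤ k) (α : ℝ) (hα : (k : ℝ) < α)
    (lam : ℝ)
    (hlam : ∀ x : EuclideanSpace ℝ (Fin N), x ≠ 0 →
      ∑ i : Fin k → Fin N,
        (pD k (fun w : EuclideanSpace ℝ (Fin N) => ‖w‖ ^ ((k : ℝ) - α)) i x) ^ 2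
        = lam * ‖x‖ ^ (-(2 * α))) :
    ∀ x : EuclideanSpace ℝ (Fin N), x ≠ 0 →
      (-1 : ℝ) ^ k *
        ∑ i : Fin k → Fin N,
          pD k (fun z : EuclideanSpace ℝ (Fin N) =>
            ‖z‖ ^ (2 * α - (N : ℝ)) *
              pD k (fun w : EuclideanSpace ℝ (Fin N) => ‖w‖ ^ ((k : ℝ) - α)) i z) i x
        = lam * ‖x‖ ^ (α - (N : ℝ) - (k : ℝ)) := by
  intro x hx
  have hpD (i : Fin k → Fin N) {z : EuclideanSpace ℝ (Fin N)} (hz : z ≠ 0) :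
      pD k (fun w : EuclideanSpace ℝ (Fin N) => ‖w‖ ^ ((k : ℝ) - α)) i z =
        (iterDeriv PuncturedSmooth.partialDeriv k i
          (PuncturedSmooth.normPow N (k - α))).eval ⟨z, hz⟩ :=
    PuncturedSmooth.pD_restrict k i _ _ (fun _ => rfl) hz
  have hlam_eq : powPairingCoeff N k (k - α) (k - α) = lam := by
    have hpos : 0 < ‖x‖ ^ (-(2 * α)) := Real.rpow_pos_of_pos (norm_pos_iff.mpr hx) _
    refine mul_right_cancel₀ hpos.ne' ?_
    rw [← hlam x hx, Finset.sum_congr rfl fun i _ => congrArg (· ^ 2) (hpD i hx),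
      PuncturedSmooth.sum_sq_iterDeriv_normPow,
      show (k : ℝ) - α + (k - α) - 2 * k = -(2 * α) by ring]
  have hdiv (i : Fin k → Fin N) : pD k (fun z : EuclideanSpace ℝ (Fin N) =>
      ‖z‖ ^ (2 * α - (N : ℝ)) *
        pD k (fun w : EuclideanSpace ℝ (Fin N) => ‖w‖ ^ ((k : ℝ) - α)) i z) i x =
      (iterDeriv PuncturedSmooth.partialDeriv k i (PuncturedSmooth.normPow N (2 * α - N) *
        iterDeriv PuncturedSmooth.partialDeriv k i
          (PuncturedSmooth.normPow N (k - α)))).eval ⟨x, hx⟩ :=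
    PuncturedSmooth.pD_restrict k i _ _ (fun y => by rw [hpD i y.2]; rfl) hx
  rw [Finset.sum_congr rfl fun i _ => hdiv i, PuncturedSmooth.sum_iterDeriv_normPow_mul,
    show 2 * (k : ℝ) - N - (2 * α - N) - (k - α) = k - α by ring,
    show 2 * α - (N : ℝ) + (k - α) - 2 * k = α - N - k by ring, hlam_eq,
    mul_assoc, ← mul_assoc, ← mul_pow]
  norm_num
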